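/- Let λ ∈ ℝ, let n, r be integers with n, r ≥ 0, and let f ∈ ℝ[[x]] be a formal power series. Then (xD+r)_{n,λ} f = Σ_{k=0}^{n} {n+r \brace k+r}_{r,λ} · x^k · D^k f. -/

import Mathlib

open Finset PowerSeries

/-- Degenerate falling factorial `(x)_{n,λ} = x(x-λ)⋯(x-(n-1)λ)`. -/
noncomputable def dfall (lam x : ℝ) (n : ℕ) : ℝ := ∏ i ∈ Finset.range n, (x - i * lam)

/-- Ordinary falling factorial `(x)_n = x(x-1)⋯(x-n+1)`. -/
noncomputable def ffall (x : ℝ) (n : ℕ) : ℝ := ∏ i ∈ Finset.range n, (x - i)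

/-- Degenerate rising factorial `⟨x⟩_{n,λ} = x(x+λ)⋯(x+(n-1)λ)`. -/
noncomputable def drise (lam x : ℝ) (n : ℕ) : ℝ := ∏ i ∈ Finset.range n, (x + i * lam)

/-- Rising factorial `⟨x⟩_n = x(x+1)⋯(x+n-1)`. -/
noncomputable def rise (x : ℝ) (n : ℕ) : ℝ := ∏ i ∈ Finset.range n, (x + i)

/-- Formal derivative `D = d/dx` on `ℝ⟦X⟧`. -/
noncomputable def D (f : PowerSeries ℝ) : PowerSeries ℝ := PowerSeries.derivativeFun f

/-- The operator `(xD + c)_{m,λ} = (xD+c)(xD+c-λ)⋯(xD+c-(m-1)λ)` applied to a power series,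
where the factor with the largest shift is applied first. -/
noncomputable def xDFall (lam c : ℝ) : ℕ → PowerSeries ℝ → PowerSeries ℝ
  | 0, f => f
  | m + 1, f => xDFall lam c m (PowerSeries.X * D f + (c - m * lam) • f)

theorem coeff_D (f : PowerSeries ℝ) (j : ℕ) :
    coeff j (D f) = coeff (j + 1) f * (j + 1) :=
  coeff_derivative f j

theorem coeff_X_mul_D (f : PowerSeries ℝ) (j : ℕ) :
    coeff j (PowerSeries.X * D f) = j * coeff j f := by
  cases j with
  | zero => simp
  | succ j =>
    rw [coeff_succ_X_mul, coeff_D]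
    push_cast
    ring

theorem coeff_xDFall (lam c : ℝ) (m : ℕ) (f : PowerSeries ℝ) (j : ℕ) :
    coeff j (xDFall lam c m f) = dfall lam (j + c) m * coeff j f := by
  induction m generalizing f with
  | zero => simp [xDFall, dfall]
  | succ m ih =>
    rw [xDFall, ih, map_add, coeff_X_mul_D, coeff_smul, smul_eq_mul, dfall, dfall,
      Finset.prod_range_succ]
    ring

theorem ffall_succ (x : ℝ) (k : ℕ) : ffall x (k + 1) = x * ffall (x - 1) k := by
  rw [ffall, ffall, Finset.prod_range_succ', mul_comm]
  congr 1
  · simp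
  · refine Finset.prod_congr rfl fun i _ => ?_
    push_cast
    ring

theorem coeff_X_pow_mul_iterate_D (k : ℕ) (f : PowerSeries ℝ) (j : ℕ) :
    coeff j (PowerSeries.X ^ k * D^[k] f) = ffall j k * coeff j f := by
  induction k generalizing f j with
  | zero => simp [ffall]
  | succ k ih =>
    rw [Function.iterate_succ_apply, pow_succ', mul_assoc, ffall_succ]
    cases j with
    | zero => simp
    | succ j =>
      rw [coeff_succ_X_mul, ih, coeff_D]
      push_cast
      rw [add_sub_cancel_right]
      ring

/-- `(xD+r)_{n,λ} f = Σ_{k=0}^{n} {n+r \brace k+r}_{r,λ} x^k D^k f`. -/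
theorem statement8 (lam : ℝ) (n r : ℕ) (S : ℕ → ℤ → ℝ)
    (hS : ∀ (m : ℕ) (x : ℝ),
      dfall lam (x + r) m = ∑ k ∈ Finset.range (m + 1), S m k * ffall x k)
    (hS0 : ∀ (m : ℕ) (k : ℤ), k < 0 ∨ (m : ℤ) < k → S m k = 0)
    (f : PowerSeries ℝ) :
    xDFall lam r n f
      = ∑ k ∈ Finset.range (n + 1), S n k • (PowerSeries.X ^ k * D^[k] f) := by
  ext j
  rw [coeff_xDFall, hS, map_sum, Finset.sum_mul]
  refine Finset.sum_congr rfl fun k _ => ?_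
  rw [coeff_smul, coeff_X_pow_mul_iterate_D, smul_eq_mul, mul_assoc]
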